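/- Let X be a compact metric space, T: P(X)×P(X) → ℝ weak* continuous and jointly convex, and T_∞ weak* lower semicontinuous and jointly convex, such that the 'Aubry set' D := {(μ,ν) : T(μ,ν) + T_∞(ν,μ) = 0} is nonempty, convex, weak* closed, and satisfies: for every μ ∈ A := {σ : T_∞(σ,σ)=0} there exists ν ∈ A with (μ,ν) ∈ D; and T(μ,μ) ≥ 0 for all μ, and T_∞(μ,μ) ≥ 0 for all μ. Then there exists μ̄ ∈ P(X) with T(μ̄, μ̄) = 0, i.e., inf{T(μ,μ) : μ ∈ P(X)} = 0 is attained. -/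

import Mathlib

open MeasureTheory NNReal

open Filter Topology

/-- The Cesàro average `(n + 1)⁻¹ ∑_{k ≤ n} μ k` of a sequence of probability measures. -/
noncomputable def cesaroAverage {X : Type*} [MeasurableSpace X]
    (μ : ℕ → ProbabilityMeasure X) (n : ℕ) : ProbabilityMeasure X :=
  ⟨((n : ℝ≥0) + 1)⁻¹ • ∑ k ∈ Finset.range (n + 1), (μ k : Measure X), ⟨by
    have h : ((n : ℝ≥0) + 1) ≠ 0 := by positivity
    simp only [Measure.smul_apply, Measure.coe_finsetSum, Finset.sum_apply, measure_univ,
      Finset.sum_const, Finset.card_range, nsmul_eq_mul, mul_one, ENNReal.smul_def, smul_eq_mul]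
    rw [show ((n + 1 : ℕ) : ENNReal) = (((n : ℝ≥0) + 1 : ℝ≥0) : ENNReal) by push_cast; rfl,
      ← ENNReal.coe_mul, inv_mul_cancel₀ h, ENNReal.coe_one]⟩⟩

section cesaroAverage

variable {X : Type*} [MeasurableSpace X] (μ : ℕ → ProbabilityMeasure X)

lemma coe_cesaroAverage (n : ℕ) :
    (cesaroAverage μ n : Measure X) =
      ((n : ℝ≥0) + 1)⁻¹ • ∑ k ∈ Finset.range (n + 1), (μ k : Measure X) := rfl

lemma cesaroAverage_zero : cesaroAverage μ 0 = μ 0 := by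
  apply Subtype.ext
  change (cesaroAverage μ 0 : Measure X) = μ 0
  simp [coe_cesaroAverage]

lemma coe_cesaroAverage_succ (n : ℕ) :
    (cesaroAverage μ (n + 1) : Measure X) =
      (((n : ℝ≥0) + 1) / ((n : ℝ≥0) + 2)) • (cesaroAverage μ n : Measure X) +
        (1 / ((n : ℝ≥0) + 2)) • (μ (n + 1) : Measure X) := by
  have h : ((n : ℝ≥0) + 1) ≠ 0 := by positivity
  rw [coe_cesaroAverage, coe_cesaroAverage, Finset.sum_range_succ _ (n + 1), smul_add, smul_smul]
  congr 2
  · push_cast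
    rw [show (n : ℝ≥0) + 1 + 1 = n + 2 by ring]
    field_simp
  · push_cast
    rw [show (n : ℝ≥0) + 1 + 1 = n + 2 by ring, one_div]

/-- A set of pairs of probability measures stable under binary convex combinations is stable
under Cesàro averages. -/
lemma cesaroAverage_of_convex {D : ProbabilityMeasure X → ProbabilityMeasure X → Prop}
    (hD : ∀ (a b : ℝ≥0), a + b = 1 → ∀ (μ₁ ν₁ μ₂ ν₂ μ ν : ProbabilityMeasure X),
      D μ₁ ν₁ → D μ₂ ν₂ →
      (μ : Measure X) = a • (μ₁ : Measure X) + b • (μ₂ : Measure X) →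
      (ν : Measure X) = a • (ν₁ : Measure X) + b • (ν₂ : Measure X) → D μ ν)
    {μ ν : ℕ → ProbabilityMeasure X} (h : ∀ n, D (μ n) (ν n)) (n : ℕ) :
    D (cesaroAverage μ n) (cesaroAverage ν n) := by
  induction n with
  | zero => simpa only [cesaroAverage_zero] using h 0
  | succ n ih =>
    refine hD _ _ ?_ _ _ _ _ _ _ ih (h (n + 1)) (coe_cesaroAverage_succ μ n)
      (coe_cesaroAverage_succ ν n)
    have h2 : ((n : ℝ≥0) + 2) ≠ 0 := by positivity
    rw [← add_div, div_eq_one_iff_eq h2]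
    ring

variable [TopologicalSpace X] [OpensMeasurableSpace X]

lemma integral_cesaroAverage (f : BoundedContinuousFunction X ℝ) (n : ℕ) :
    ∫ x, f x ∂(cesaroAverage μ n : Measure X) =
      ((n : ℝ) + 1)⁻¹ * ∑ k ∈ Finset.range (n + 1), ∫ x, f x ∂(μ k : Measure X) := by
  rw [coe_cesaroAverage, integral_smul_nnreal_measure,
    integral_finsetSum_measure fun k _ => f.integrable _]
  simp [NNReal.smul_def]

/-- Shifting a sequence does not change the integrals of its Cesàro averages asymptotically. -/
lemma tendsto_integral_cesaroAverage_shift_sub (f : BoundedContinuousFunction X ℝ) :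
    Tendsto (fun n => ∫ x, f x ∂(cesaroAverage (fun k => μ (k + 1)) n : Measure X) -
      ∫ x, f x ∂(cesaroAverage μ n : Measure X)) atTop (𝓝 0) := by
  have key (n : ℕ) : ∫ x, f x ∂(cesaroAverage (fun k => μ (k + 1)) n : Measure X) -
      ∫ x, f x ∂(cesaroAverage μ n : Measure X) =
      ((n : ℝ) + 1)⁻¹ * (∫ x, f x ∂(μ (n + 1) : Measure X) - ∫ x, f x ∂(μ 0 : Measure X)) := by
    rw [integral_cesaroAverage, integral_cesaroAverage, ← mul_sub, ← Finset.sum_sub_distrib,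
      Finset.sum_range_sub (fun k => ∫ x, f x ∂(μ k : Measure X))]
  simp_rw [key]
  have h0 : Tendsto (fun n : ℕ => ((n : ℝ) + 1)⁻¹) atTop (𝓝 0) := by
    simpa only [one_div] using tendsto_one_div_add_atTop_nhds_zero_nat (𝕜 := ℝ)
  refine h0.zero_mul_isBoundedUnder_le ?_
  refine isBoundedUnder_of ⟨‖f‖ + ‖f‖, fun n => ?_⟩
  exact (norm_sub_le _ _).trans (add_le_add (f.norm_integral_le_norm _) (f.norm_integral_le_norm _))

end cesaroAverage

/-- Generalized Mather theorem: under the stated conditions on the transfer `T`, the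
extended transfer `T_∞`, the projected Aubry set `A = {σ : T_∞(σ,σ) = 0}` and the
generalized Aubry set `D = {(μ,ν) : T(μ,ν) + T_∞(ν,μ) = 0}`, the infimum
`inf {T(μ,μ) : μ ∈ P(X)} = 0` is attained. -/
theorem mather_min_attained
    {X : Type*} [MetricSpace X] [CompactSpace X] [MeasurableSpace X] [BorelSpace X]
    (T Tinf : ProbabilityMeasure X → ProbabilityMeasure X → ℝ)
    (hTcont : Continuous
      (fun p : ProbabilityMeasure X × ProbabilityMeasure X => T p.1 p.2))
    (hTconvex : ∀ (a b : ℝ≥0), a + b = 1 →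
      ∀ (μ₁ μ₂ ν₁ ν₂ μ ν : ProbabilityMeasure X),
        (μ : Measure X) = a • (μ₁ : Measure X) + b • (μ₂ : Measure X) →
        (ν : Measure X) = a • (ν₁ : Measure X) + b • (ν₂ : Measure X) →
        T μ ν ≤ a * T μ₁ ν₁ + b * T μ₂ ν₂)
    (hlsc : LowerSemicontinuous
      (fun p : ProbabilityMeasure X × ProbabilityMeasure X => Tinf p.1 p.2))
    (hTinfconvex : ∀ (a b : ℝ≥0), a + b = 1 →
      ∀ (μ₁ μ₂ ν₁ ν₂ μ ν : ProbabilityMeasure X),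
        (μ : Measure X) = a • (μ₁ : Measure X) + b • (μ₂ : Measure X) →
        (ν : Measure X) = a • (ν₁ : Measure X) + b • (ν₂ : Measure X) →
        Tinf μ ν ≤ a * Tinf μ₁ ν₁ + b * Tinf μ₂ ν₂)
    (hDnonempty : ({p : ProbabilityMeasure X × ProbabilityMeasure X |
      T p.1 p.2 + Tinf p.2 p.1 = 0}).Nonempty)
    (hDconvex : ∀ (a b : ℝ≥0), a + b = 1 →
      ∀ (μ₁ ν₁ μ₂ ν₂ μ ν : ProbabilityMeasure X),
        T μ₁ ν₁ + Tinf ν₁ μ₁ = 0 → T μ₂ ν₂ + Tinf ν₂ μ₂ = 0 →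
        (μ : Measure X) = a • (μ₁ : Measure X) + b • (μ₂ : Measure X) →
        (ν : Measure X) = a • (ν₁ : Measure X) + b • (ν₂ : Measure X) →
        T μ ν + Tinf ν μ = 0)
    (hDclosed : IsClosed ({p : ProbabilityMeasure X × ProbabilityMeasure X |
      T p.1 p.2 + Tinf p.2 p.1 = 0}))
    (hAnonempty : ({σ : ProbabilityMeasure X | Tinf σ σ = 0}).Nonempty)
    (hchain : ∀ μ : ProbabilityMeasure X, Tinf μ μ = 0 →
      ∃ ν : ProbabilityMeasure X, Tinf ν ν = 0 ∧ T μ ν + Tinf ν μ = 0)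
    (hTnonneg : ∀ μ : ProbabilityMeasure X, 0 ≤ T μ μ)
    (hTinfnonneg : ∀ μ : ProbabilityMeasure X, 0 ≤ Tinf μ μ) :
    ∃ μbar : ProbabilityMeasure X, T μbar μbar = 0 := by
  choose next hnext hstep using hchain
  obtain ⟨σ, hσ⟩ := hAnonempty
  let orbit : ℕ → {ρ : ProbabilityMeasure X // Tinf ρ ρ = 0} :=
    fun n => (fun ρ => ⟨next ρ.1 ρ.2, hnext ρ.1 ρ.2⟩)^[n] ⟨σ, hσ⟩
  let μ : ℕ → ProbabilityMeasure X := fun n => (orbit n).1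
  have hμ (n : ℕ) : T (μ n) (μ (n + 1)) + Tinf (μ (n + 1)) (μ n) = 0 := by
    simp only [μ, orbit, Function.iterate_succ_apply']
    exact hstep _ _
  have havg (n : ℕ) := cesaroAverage_of_convex
    (D := fun μ ν => T μ ν + Tinf ν μ = 0) hDconvex hμ n
  let U : Ultrafilter ℕ := hyperfilter ℕ
  have hU : (U : Filter ℕ) ≤ atTop := Nat.hyperfilter_le_atTop
  obtain ⟨μbar, -, hlim⟩ := isCompact_univ.ultrafilter_le_nhds' (U.map (cesaroAverage μ))
    univ_mem
  have hlim : Tendsto (cesaroAverage μ) U (𝓝 μbar) := hlim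
  have hlim_shift : Tendsto (cesaroAverage fun k => μ (k + 1)) U (𝓝 μbar) := by
    rw [ProbabilityMeasure.tendsto_iff_forall_integral_tendsto] at hlim ⊢
    intro f
    simpa using ((tendsto_integral_cesaroAverage_shift_sub μ f).mono_left hU).add (hlim f)
  have hmem := hDclosed.mem_of_tendsto (hlim.prodMk_nhds hlim_shift) (Eventually.of_forall havg)
  have hsum : T μbar μbar + Tinf μbar μbar = 0 := hmem
  exact ⟨μbar, by linarith [hTnonneg μbar, hTinfnonneg μbar]⟩
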